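/- Let N = n·P with n ≥ 3, let A ∈ ℂ^{N×P} have all blocks A_m = e_m^T A ∈ ℂ^{P×P} invertible, let Γ_s ∈ ℂ^{P×P} be invertible, σ ≥ 0, and Γ = AΓ_sA^* + σ²I_N with blocks Γ_{ij} = e_i^T Γ e_j. Fix i ∈ {1,…,n} and for each j ≠ i choose an index k(j) ∈ {1,…,n} with k(j) ≠ i and k(j) ≠ j. Then the i-th extended propagator Ψ_{ni} := ∑_{j≠i} Γ_{i,k(j)}Γ_{j,k(j)}^{−1} e_j^T − (n−1) e_i^T ∈ ℂ^{P×N} annihilates the channel matrix: Ψ_{ni}·A = 0_{P×P}. -/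

import Mathlib

open Matrix

/-- The `i`-th selection matrix `e_i ∈ ℂ^{(n·P)×P}`, with entry `(r,s)` equal to `1`
iff `r = i·P + s` (0-indexed version of `r = (i−1)P + s`). -/
def selMat (n P : ℕ) (i : Fin n) : Matrix (Fin (n * P)) (Fin P) ℂ :=
  Matrix.of fun r s => if (r : ℕ) = i * P + s then 1 else 0

lemma conjTranspose_transpose_selMat (n P : ℕ) (i : Fin n) :
    (selMat n P i)ᵀᴴ = selMat n P i := by
  ext r s
  simp only [selMat, conjTranspose_apply, transpose_apply, of_apply]
  split_ifs <;> simp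

lemma transpose_selMat_mul_selMat_of_ne {n P : ℕ} {i j : Fin n} (h : i ≠ j) :
    (selMat n P i)ᵀ * selMat n P j = 0 := by
  ext s t
  simp only [selMat, mul_apply, transpose_apply, of_apply, Matrix.zero_apply]
  refine Finset.sum_eq_zero fun r _ => ?_
  rw [ite_zero_mul_ite_zero, if_neg]
  rintro ⟨h₁, h₂⟩
  apply h
  have hP : 0 < P := s.pos
  have hdiv (m : ℕ) (u : Fin P) : (m * P + u) / P = m := by
    rw [mul_comm, Nat.mul_add_div hP, Nat.div_eq_of_lt u.isLt, add_zero]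
  apply Fin.ext
  rw [← hdiv i s, ← h₁, h₂, hdiv]

/-- The off-diagonal blocks of the covariance are noise-free. -/
lemma covariance_block_of_ne {n P : ℕ} (A : Matrix (Fin (n * P)) (Fin P) ℂ)
    (Γs : Matrix (Fin P) (Fin P) ℂ) (c : ℂ) {i j : Fin n} (h : i ≠ j) :
    (selMat n P i)ᵀ * (A * Γs * Aᴴ + c • 1) * selMat n P j =
      ((selMat n P i)ᵀ * A) * (Γs * ((selMat n P j)ᵀ * A)ᴴ) := by
  rw [conjTranspose_mul, conjTranspose_transpose_selMat, Matrix.mul_add, Matrix.add_mul,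
    Matrix.mul_smul, Matrix.smul_mul, Matrix.mul_one, transpose_selMat_mul_selMat_of_ne h,
    smul_zero, add_zero]
  simp only [Matrix.mul_assoc]

lemma mul_nonsing_inv_mul_cancel_of_isUnit {m : Type*} [Fintype m] [DecidableEq m]
    (X : Matrix m m ℂ) {Y M : Matrix m m ℂ} (hY : IsUnit Y) (hM : IsUnit M) :
    X * M * (Y * M)⁻¹ * Y = X := by
  rw [isUnit_iff_isUnit_det] at hY hM
  rw [Matrix.mul_inv_rev, ← Matrix.mul_assoc, Matrix.mul_nonsing_inv_cancel_right _ _ hM,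
    Matrix.nonsing_inv_mul_cancel_right _ _ hY]

/-- The `i`-th extended propagator
`Ψ_{ni} = ∑_{j≠i} Γ_{i,k(j)}Γ_{j,k(j)}⁻¹ e_jᵀ − (n−1) e_iᵀ`
annihilates the channel matrix: `Ψ_{ni}·A = 0`. -/
theorem extended_propagator_annihilates (n P : ℕ) (hn : 3 ≤ n) (hP : 1 ≤ P)
    (A : Matrix (Fin (n * P)) (Fin P) ℂ)
    (hA : ∀ m : Fin n, IsUnit ((selMat n P m)ᵀ * A))
    (Γs : Matrix (Fin P) (Fin P) ℂ) (hΓs : IsUnit Γs)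
    (σ : ℝ) (hσ : 0 ≤ σ)
    (Γ : Matrix (Fin (n * P)) (Fin (n * P)) ℂ)
    (hΓ : Γ = A * Γs * Aᴴ + ((σ : ℂ) ^ 2) • 1)
    (i : Fin n) (k : Fin n → Fin n)
    (hk : ∀ j : Fin n, j ≠ i → k j ≠ i ∧ k j ≠ j) :
    (∑ j ∈ Finset.univ.erase i,
        ((selMat n P i)ᵀ * Γ * selMat n P (k j)) *
          ((selMat n P j)ᵀ * Γ * selMat n P (k j))⁻¹ * (selMat n P j)ᵀ
      - ((n : ℂ) - 1) • (selMat n P i)ᵀ) * A = 0 := by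
  have hterm : ∀ j ∈ Finset.univ.erase i,
      ((selMat n P i)ᵀ * Γ * selMat n P (k j)) *
        ((selMat n P j)ᵀ * Γ * selMat n P (k j))⁻¹ * (selMat n P j)ᵀ * A =
      (selMat n P i)ᵀ * A := by
    intro j hj
    obtain ⟨hki, hkj⟩ := hk j (Finset.ne_of_mem_erase hj)
    have hM : IsUnit (Γs * ((selMat n P (k j))ᵀ * A)ᴴ) := hΓs.mul (hA (k j)).star
    rw [hΓ, covariance_block_of_ne A Γs _ hki.symm, covariance_block_of_ne A Γs _ hkj.symm,
      Matrix.mul_assoc _ _ A, mul_nonsing_inv_mul_cancel_of_isUnit _ (hA j) hM]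
  rw [Matrix.sub_mul, Matrix.sum_mul, Finset.sum_congr rfl hterm, Finset.sum_const,
    Finset.card_erase_of_mem (Finset.mem_univ i), Finset.card_univ, Fintype.card_fin,
    Matrix.smul_mul, ← Nat.cast_smul_eq_nsmul ℂ, Nat.cast_sub (by omega), Nat.cast_one, sub_self]
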